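/- For every natural number k, every natural number m < 2^k, and every natural number N, there exists n > N with DI(m) ≤ DI(n) < DI(m) + 2^{−k}; that is, every finite binary fractional string of length k occurs as the initial digit string of DI(n) for infinitely many positions n (indeed for every n ≡ m (mod 2^k)). -/

import Mathlib

/-- The digit-reversal map: `DI(n) = ∑_i bit_i(n)·2^{-(i+1)}`, where
`bit_i(n) = ⌊n/2^i⌋ mod 2` (all bits with index `i ≥ n` vanish). -/
def DI (n : ℕ) : ℚ := ∑ i ∈ Finset.range n, ((n / 2 ^ i % 2 : ℕ) : ℚ) / 2 ^ (i + 1)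

theorem DI_ext (n M : ℕ) (h : n ≤ M) :
    DI n = ∑ i ∈ Finset.range M, ((n / 2 ^ i % 2 : ℕ) : ℚ) / 2 ^ (i + 1) := by
  unfold DI
  apply Finset.sum_subset
  · intro i hi
    simp only [Finset.mem_range] at *
    omega
  · intro i _ hi
    simp only [Finset.mem_range, not_lt] at hi
    have : n / 2 ^ i = 0 := Nat.div_eq_of_lt (lt_of_le_of_lt hi Nat.lt_two_pow_self)
    simp [this]

theorem DI_rec (n : ℕ) : DI n = ((n % 2 : ℕ) : ℚ) / 2 + DI (n / 2) / 2 := by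
  rw [DI_ext n (n + 1) (by omega), DI_ext (n / 2) n (by omega), Finset.sum_range_succ',
    Finset.sum_div, add_comm]
  congr 1
  · simp
  · apply Finset.sum_congr rfl
    intro i _
    rw [Nat.div_div_eq_div_mul, ← pow_succ', pow_succ (2 : ℚ) (i + 1), div_div]

theorem DI_nonneg (n : ℕ) : 0 ≤ DI n := by
  unfold DI
  positivity

theorem DI_lt_one (n : ℕ) : DI n < 1 := by
  induction n using Nat.strong_induction_on with
  | _ n ih =>
    rcases Nat.eq_zero_or_pos n with rfl | h
    · simp [DI]
    · have h1 := ih (n / 2) (by omega)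
      have h2 : ((n % 2 : ℕ) : ℚ) ≤ 1 := by
        exact_mod_cast (by omega : n % 2 ≤ 1)
      rw [DI_rec]
      linarith

theorem DI_mod (k : ℕ) : ∀ n : ℕ, DI (n % 2 ^ k) ≤ DI n ∧ DI n < DI (n % 2 ^ k) + 1 / 2 ^ k := by
  induction k with
  | zero =>
    intro n
    have h0 : DI 0 = 0 := by simp [DI]
    simpa [Nat.mod_one, h0] using And.intro (DI_nonneg n) (DI_lt_one n)
  | succ k ih =>
    intro n
    obtain ⟨h1, h2⟩ := ih (n / 2)
    have e1 : n % 2 ^ (k + 1) % 2 = n % 2 :=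
      Nat.mod_mod_of_dvd _ (dvd_pow_self 2 (by omega))
    have e2 : n % 2 ^ (k + 1) / 2 = n / 2 % 2 ^ k := by
      rw [pow_succ', Nat.mod_mul_right_div_self]
    rw [DI_rec n, DI_rec (n % 2 ^ (k + 1)), e1, e2]
    have e3 : (1 : ℚ) / 2 ^ (k + 1) = 1 / 2 ^ k / 2 := by rw [pow_succ, div_div]
    rw [e3]
    constructor <;> linarith

theorem stmt_5 :
    ∀ k m N : ℕ, m < 2 ^ k →
      ∃ n : ℕ, N < n ∧ DI m ≤ DI n ∧ DI n < DI m + 1 / 2 ^ k := by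
  intro k m N hm
  refine ⟨m + 2 ^ k * (N + 1), ?_, ?_⟩
  · have : 1 ≤ 2 ^ k := Nat.one_le_two_pow
    nlinarith
  · have h := DI_mod k (m + 2 ^ k * (N + 1))
    rwa [Nat.add_mul_mod_self_left, Nat.mod_eq_of_lt hm] at h
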